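/- arXiv:1504.02240 — 6 statements merged into one kernel-verified Lean document; each statement's English description precedes it below -/
import Mathlib

section
/- Let Q be a unital C*-algebra and let x ∈ Q satisfy x² x* = x and x* x² = x. Then x is normal, i.e. x x* = x* x. -/
/-- Normality criterion (used in Lemma 3.2): if `x² x* = x` and `x* x² = x`
in a unital C*-algebra, then `x` is normal. -/
theorem normal_of_sq_mul_star {Q : Type*} [NormedRing Q] [StarRing Q] [CStarRing Q]
    [NormedAlgebra ℂ Q] [StarModule ℂ Q] [CompleteSpace Q]
    (x : Q)
    (h1 : x ^ 2 * star x = x)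
    (h2 : star x * x ^ 2 = x) :
    x * star x = star x * x := by
  have a : x * (star x * star x) = star x := by
    have h := congrArg star h1
    have h' := congrArg star h2
    simp only [star_mul, star_star, pow_two] at h h'
    first | exact h | exact h'
  have b : star x * star x * x = star x := by
    have h := congrArg star h1
    have h' := congrArg star h2
    simp only [star_mul, star_star, pow_two] at h h'
    first | exact h' | (rw [mul_assoc] at *; exact h')
  have h3 : star x * star x * x = star x := b
  calc x * star x = x * (star x * star x * x) := by rw [h3]
    _ = x * (star x * star x) * x := by rw [mul_assoc x]
    _ = star x * x := by rw [a]
end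

section
/- Let Q be a unital C*-algebra, let c ∈ Q, and let g, h, k, l ∈ Q be normal elements such that kg = 0, kh = 0, lg = 0, lh = 0, and such that c(g g* + h h*) = c and c(k k* + l l*) = c. Then c = 0. -/
/-- Distilled form of Lemma 3.3: `c = c(k k* + l l*)(g g* + h h*) = 0`. -/
theorem vanishing_off_diagonal {Q : Type*} [NormedRing Q] [StarRing Q] [CStarRing Q]
    [NormedAlgebra ℂ Q] [StarModule ℂ Q] [CompleteSpace Q]
    (c g h k l : Q)
    (hg : g * star g = star g * g)
    (hh : h * star h = star h * h)
    (hk : k * star k = star k * k)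
    (hl : l * star l = star l * l)
    (hkg : k * g = 0) (hkh : k * h = 0)
    (hlg : l * g = 0) (hlh : l * h = 0)
    (hc1 : c * (g * star g + h * star h) = c)
    (hc2 : c * (k * star k + l * star l) = c) :
    c = 0 := by
  have h0 : (k * star k + l * star l) * (g * star g + h * star h) = 0 := by
    have e : (k * star k + l * star l) * (g * star g + h * star h)
        = star k * (k * g) * star g + star k * (k * h) * star h
          + star l * (l * g) * star g + star l * (l * h) * star h := by
      rw [hk, hl]; noncomm_ring
    rw [e, hkg, hkh, hlg, hlh]; simp
  calc c = c * (k * star k + l * star l) * (g * star g + h * star h) := by rw [hc2, hc1]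
    _ = 0 := by rw [mul_assoc, h0, mul_zero]
end

section
/- Let Q be a unital C*-algebra and let A, B, I, J ∈ Q be normal elements satisfying I I* + J J* = 1, I² I* = I, J² J* = J, J A I = A I B, I B J = B J A, I B I = 0, and J A J = 0. Then J A = 0, A J = 0, I B = 0, and B I = 0. -/
theorem normal_left {Q : Type*} [NormedRing Q] [StarRing Q] [CStarRing Q] (x y : Q)
    (hx : x * star x = star x * x) (h : x * y = 0) : star x * y = 0 := by
  rw [← CStarRing.star_mul_self_eq_zero_iff]
  calc star (star x * y) * (star x * y) = star y * (x * star x) * y := by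
        simp only [star_mul, star_star, mul_assoc]
    _ = star y * star x * (x * y) := by rw [hx]; simp only [mul_assoc]
    _ = 0 := by rw [h, mul_zero]

theorem normal_swap {Q : Type*} [NormedRing Q] [StarRing Q] [CStarRing Q] (x y : Q)
    (hx : x * star x = star x * x) (hy : y * star y = star y * y) (h : x * y = 0) :
    y * x = 0 := by
  have h1 : star y * x = 0 := by
    have := congrArg star (normal_left x y hx h)
    simpa using this
  have h2 := normal_left (star y) x (by simpa using hy.symm) h1
  simpa using h2

/-- Key computation in Lemma 3.4 for the braid group `B₃`. -/
theorem braid_vanishing {Q : Type*} [NormedRing Q] [StarRing Q] [CStarRing Q]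
    [NormedAlgebra ℂ Q] [StarModule ℂ Q] [CompleteSpace Q]
    (A B I J : Q)
    (hA : A * star A = star A * A)
    (hB : B * star B = star B * B)
    (hI : I * star I = star I * I)
    (hJ : J * star J = star J * J)
    (hIJ : I * star I + J * star J = 1)
    (hI2 : I ^ 2 * star I = I)
    (hJ2 : J ^ 2 * star J = J)
    (h1 : J * A * I = A * I * B)
    (h2 : I * B * J = B * J * A)
    (h3 : I * B * I = 0)
    (h4 : J * A * J = 0) :
    J * A = 0 ∧ A * J = 0 ∧ I * B = 0 ∧ B * I = 0 := by
  have a1 : J * A * I = 0 := by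
    calc J * A * I = J * A * (I ^ 2 * star I) := by rw [hI2]
      _ = (J * A * I) * I * star I := by simp only [pow_two, mul_assoc]
      _ = A * (I * B * I) * star I := by rw [h1]; simp only [mul_assoc]
      _ = 0 := by rw [h3]; simp
  have a2 : I * B * J = 0 := by
    calc I * B * J = I * B * (J ^ 2 * star J) := by rw [hJ2]
      _ = (I * B * J) * J * star J := by simp only [pow_two, mul_assoc]
      _ = B * (J * A * J) * star J := by rw [h2]; simp only [mul_assoc]
      _ = 0 := by rw [h4]; simp
  have b1 : J * A = 0 := by
    calc J * A = J * A * (I * star I + J * star J) := by rw [hIJ, mul_one]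
      _ = (J * A * I) * star I + (J * A * J) * star J := by simp only [mul_add, mul_assoc]
      _ = 0 := by rw [a1, h4]; simp
  have b2 : I * B = 0 := by
    calc I * B = I * B * (I * star I + J * star J) := by rw [hIJ, mul_one]
      _ = (I * B * I) * star I + (I * B * J) * star J := by simp only [mul_add, mul_assoc]
      _ = 0 := by rw [a2, h3]; simp
  exact ⟨b1, normal_swap J A hJ hA b1, b2, normal_swap I B hI hB b2⟩
end

section
/- Let Q be a unital C*-algebra and let u, v ∈ Q satisfy u v + v u = 0 and u* = (u² + v²)u. Then u is normal, i.e. u u* = u* u. -/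
/-- Normality argument in Theorem 4.1: if `u v + v u = 0` and `u* = (u² + v²)u`,
then `u` is normal. -/
theorem normal_of_anticomm {Q : Type*} [NormedRing Q] [StarRing Q] [CStarRing Q]
    [NormedAlgebra ℂ Q] [StarModule ℂ Q] [CompleteSpace Q]
    (u v : Q)
    (h1 : u * v + v * u = 0)
    (h2 : star u = (u ^ 2 + v ^ 2) * u) :
    u * star u = star u * u := by
  have h : u * v = -(v * u) := eq_neg_of_add_eq_zero_left h1
  have h3 : u * v ^ 2 = v ^ 2 * u := by
    rw [pow_two, ← mul_assoc, h, neg_mul, mul_assoc, h, mul_neg, neg_neg, mul_assoc]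
  have h4 : u * (u ^ 2 + v ^ 2) = (u ^ 2 + v ^ 2) * u := by
    rw [mul_add, add_mul, h3, ← pow_succ', ← pow_succ]
  rw [h2, ← mul_assoc, h4]
end

section
/- Let Q be a unital C*-algebra and let u, v ∈ Q satisfy u* = (u² + v²)u, v* = (u² + v²)v, and u v* + v u* = 0. Then u v + v u = 0. -/
/-- Derivation of the anticommutation relation in Theorem 4.1. -/
theorem anticomm_of_relations {Q : Type*} [NormedRing Q] [StarRing Q] [CStarRing Q]
    [NormedAlgebra ℂ Q] [StarModule ℂ Q] [CompleteSpace Q]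
    (u v : Q)
    (h1 : star u = (u ^ 2 + v ^ 2) * u)
    (h2 : star v = (u ^ 2 + v ^ 2) * v)
    (h3 : u * star v + v * star u = 0) :
    u * v + v * u = 0 := by
  have h : star u * star v + star v * star u = 0 := by
    calc star u * star v + star v * star u
        = (u ^ 2 + v ^ 2) * u * star v + (u ^ 2 + v ^ 2) * v * star u :=
          congrArg₂ (· + ·) (congrArg (· * star v) h1) (congrArg (· * star u) h2)
      _ = (u ^ 2 + v ^ 2) * (u * star v + v * star u) := by
          rw [mul_add, mul_assoc, mul_assoc]
      _ = 0 := by rw [h3, mul_zero]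
  have h' := congrArg star h
  simp only [star_add, star_mul, star_star, star_zero] at h'
  rw [add_comm]
  exact h'
end

section
/- Let Q be a unital C*-algebra and let A, B, C, G, H, K ∈ Q be self-adjoint elements satisfying A G = 0, C K = 0, B H = 0, A H = B G, B K = C H, H A = G B, H C = K B, G H + H G = 0, K H + H K = 0, G² + H² + K² = 1, and A² + B² + C² = 1. Then B = 0 and H = 0. -/
/-- Distilled computation of Section 5.2 (quantum isometry group of
`(ℤ₂ ∗ ℤ₂) × ℤ₂`): `B = 0` and `H = 0`. -/
theorem Z2Z2Z2_vanishing {Q : Type*} [NormedRing Q] [StarRing Q] [CStarRing Q]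
    [NormedAlgebra ℂ Q] [StarModule ℂ Q] [CompleteSpace Q]
    (A B C G H K : Q)
    (hA : star A = A) (hB : star B = B) (hC : star C = C)
    (hG : star G = G) (hH : star H = H) (hK : star K = K)
    (h1 : A * G = 0)
    (h2 : C * K = 0)
    (h3 : B * H = 0)
    (h4 : A * H = B * G)
    (h5 : B * K = C * H)
    (h6 : H * A = G * B)
    (h7 : H * C = K * B)
    (h8 : G * H + H * G = 0)
    (h9 : K * H + H * K = 0)
    (h10 : G ^ 2 + H ^ 2 + K ^ 2 = 1)
    (h11 : A ^ 2 + B ^ 2 + C ^ 2 = 1) :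
    B = 0 ∧ H = 0 := by
  have e8 : H * G = -(G * H) := eq_neg_of_add_eq_zero_right h8
  have e9 : H * K = -(K * H) := eq_neg_of_add_eq_zero_right h9
  have hBG : B * G * G = 0 := by
    rw [← h4, mul_assoc, e8, mul_neg, ← mul_assoc, h1, zero_mul, neg_zero]
  have hBK : B * K * K = 0 := by
    rw [h5, mul_assoc, e9, mul_neg, ← mul_assoc, h2, zero_mul, neg_zero]
  have hB0 : B = 0 := by
    calc B = B * (G ^ 2 + H ^ 2 + K ^ 2) := by rw [h10, mul_one]
      _ = B * G * G + B * H * H + B * K * K := by noncomm_ring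
      _ = 0 := by rw [hBG, hBK, h3]; simp
  refine ⟨hB0, ?_⟩
  calc H = H * (A ^ 2 + B ^ 2 + C ^ 2) := by rw [h11, mul_one]
    _ = H * A * A + H * B * B + H * C * C := by noncomm_ring
    _ = 0 := by rw [h6, h7, hB0]; simp
end
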